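/- Let R and S be 2×2 complex matrices. Let R′ be the 4×4 real matrix obtained from R by replacing each entry w by the 2×2 real block with rows (Re w, −Im w), (Im w, Re w), and let S′ be the 4×4 real matrix obtained from S by replacing each entry w by the 2×2 real block with rows (Re w, Im w), (Im w, −Re w). Then det(R′ + S′) equals the determinant of the 4×4 complex block matrix with block rows (R, S), (conj(S), conj(R)), where conj denotes entrywise complex conjugation. -/

import Mathlib

open Matrix Complex

/-- The 4×4 real matrix obtained from a 2×2 complex matrix `R` by replacing each entry
`w` by the 2×2 block `[[Re w, -Im w], [Im w, Re w]]`. -/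
def realifyR (R : Matrix (Fin 2) (Fin 2) ℂ) : Matrix (Fin 4) (Fin 4) ℝ :=
  !![(R 0 0).re, -(R 0 0).im, (R 0 1).re, -(R 0 1).im;
     (R 0 0).im,  (R 0 0).re, (R 0 1).im,  (R 0 1).re;
     (R 1 0).re, -(R 1 0).im, (R 1 1).re, -(R 1 1).im;
     (R 1 0).im,  (R 1 0).re, (R 1 1).im,  (R 1 1).re]

/-- The 4×4 real matrix obtained from a 2×2 complex matrix `S` by replacing each entry
`w` by the 2×2 block `[[Re w, Im w], [Im w, -Re w]]`. -/
def realifyS (S : Matrix (Fin 2) (Fin 2) ℂ) : Matrix (Fin 4) (Fin 4) ℝ :=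
  !![(S 0 0).re,  (S 0 0).im, (S 0 1).re,  (S 0 1).im;
     (S 0 0).im, -(S 0 0).re, (S 0 1).im, -(S 0 1).re;
     (S 1 0).re,  (S 1 0).im, (S 1 1).re,  (S 1 1).im;
     (S 1 0).im, -(S 1 0).re, (S 1 1).im, -(S 1 1).re]

/-- The matrix sending real coordinates `(x₁, y₁, x₂, y₂)` to `(z₁, z₂, conj z₁, conj z₂)`,
where `zⱼ = xⱼ + yⱼ * I`. -/
noncomputable def conjCoordMatrix : Matrix (Fin 4) (Fin 4) ℂ :=
  !![1, I, 0, 0;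
     0, 0, 1, I;
     1, -I, 0, 0;
     0, 0, 1, -I]

theorem det_conjCoordMatrix : conjCoordMatrix.det = 4 := by
  simp [conjCoordMatrix, det_succ_row_zero, Fin.sum_univ_succ, Fin.succAbove]
  ring_nf
  norm_num

/-- In the coordinates `conjCoordMatrix`, the real-linear map `z ↦ R z + S (conj z)` has block
matrix with block rows `(R, S)`, `(conj S, conj R)`. -/
theorem conjCoordMatrix_mul_realify (R S : Matrix (Fin 2) (Fin 2) ℂ) :
    conjCoordMatrix * (realifyR R + realifyS S).map ((↑) : ℝ → ℂ) =
      reindex finSumFinEquiv finSumFinEquiv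
        (fromBlocks R S (S.map (starRingEnd ℂ)) (R.map (starRingEnd ℂ))) * conjCoordMatrix := by
  have h0 : (finSumFinEquiv (m := 2) (n := 2)).symm 0 = Sum.inl 0 := rfl
  have h1 : (finSumFinEquiv (m := 2) (n := 2)).symm 1 = Sum.inl 1 := rfl
  have h2 : (finSumFinEquiv (m := 2) (n := 2)).symm 2 = Sum.inr 0 := rfl
  have h3 : (finSumFinEquiv (m := 2) (n := 2)).symm 3 = Sum.inr 1 := rfl
  ext i j
  fin_cases i <;> fin_cases j <;>
    simp [conjCoordMatrix, realifyR, realifyS, Matrix.mul_apply, Fin.sum_univ_four,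
      h0, h1, h2, h3, Complex.ext_iff] <;>
    ring_nf

/-- Lemma 6.1: `det(R' + S')` equals the determinant of the complex block matrix
with block rows `(R, S)`, `(conj S, conj R)`. -/
theorem det_realify_add (R S : Matrix (Fin 2) (Fin 2) ℂ) :
    ((realifyR R + realifyS S).det : ℂ) =
      (Matrix.fromBlocks R S (S.map (starRingEnd ℂ)) (R.map (starRingEnd ℂ))).det := by
  have h := congrArg det (conjCoordMatrix_mul_realify R S)
  rw [det_mul, det_mul, det_reindex_self, det_conjCoordMatrix, mul_comm] at h
  rw [← mul_right_cancel₀ (by norm_num : (4 : ℂ) ≠ 0) h]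
  exact Complex.ofRealHom.map_det _
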